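/- Let 𝒯_0 be a colored initial triangulation and T ∈ 𝕄 a d-simplex of the master tree. Then: (1) every edge e ∈ ℰ(T) satisfies level#(e) = level(e) + 1; (2) for every m-subsimplex S of T with m ≥ 2, the bisection edge bse(S) is the #-oldest edge of S, i.e. gen#(bse(S)) < gen#(e') for every edge e' of S different from bse(S); (3) gen(T) + 1 = gen#(bse(T)); (4) if an edge e ∈ ℰ(T) is bisected into edges e_1 and e_2, then gen#(e_1) = gen#(e_2) = gen#(e) + d, level#(e_1) = level#(e_2) = level#(e) + 1, and type#(e_1) = type#(e_2) = type#(e). -/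

import Mathlib

noncomputable section

namespace BisecGrading

/-- Points of `ℝ^d`. -/
abbrev Pt (d : ℕ) : Type := Fin d → ℝ

/-- Integer ceiling `⌈g / d⌉` (for `d > 0`). -/
def lvlZ (d : ℕ) (g : ℤ) : ℤ := (g + d - 1) / d

/-- The type `g - d * (⌈g/d⌉ - 1)` of a generation `g`. -/
def typZ (d : ℕ) (g : ℤ) : ℤ := g - d * (lvlZ d g - 1)

/-- A `d`-simplex, given by its ordered vertex list (in Maubach's ordering) together
with its generation counter. -/
structure Simplex (d : ℕ) where
  vertex : Fin (d + 1) → Pt d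
  gen : ℕ

namespace Simplex

variable {d : ℕ}

instance : DecidableEq (Simplex d) := Classical.decEq _

/-- Maubach's index `k = d - (gen T % d)`. -/
def k (T : Simplex d) : ℕ := d - T.gen % d

lemma k_le (T : Simplex d) : T.k ≤ d := Nat.sub_le _ _

/-- `k` as an index into the vertex list. -/
def kIdx (T : Simplex d) : Fin (d + 1) := ⟨T.k, Nat.lt_succ_of_le T.k_le⟩

/-- The bisection vertex `(v₀ + v_k)/2`. -/
def bsv (T : Simplex d) : Pt d := midpoint ℝ (T.vertex 0) (T.vertex T.kIdx)

/-- The bisection edge `[v₀, v_k]`, as an unordered pair of points. -/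
def bse (T : Simplex d) : Sym2 (Pt d) := s(T.vertex 0, T.vertex T.kIdx)

/-- The first child `[v₀, …, v_{k-1}, v', v_{k+1}, …, v_d]` of Maubach's bisection. -/
def child1 (T : Simplex d) : Simplex d where
  vertex := Function.update T.vertex T.kIdx T.bsv
  gen := T.gen + 1

/-- The second child `[v₁, …, v_k, v', v_{k+1}, …, v_d]` of Maubach's bisection. -/
def child2 (T : Simplex d) : Simplex d where
  vertex := fun i =>
    if h : (i : ℕ) < T.k then
      T.vertex ⟨(i : ℕ) + 1, by have hk := T.k_le; omega⟩
    else if (i : ℕ) = T.k then T.bsv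
    else T.vertex i
  gen := T.gen + 1

/-- `T'` is a child of `T`. -/
def IsChild (T' T : Simplex d) : Prop := T' = T.child1 ∨ T' = T.child2

/-- The vertex set `𝒱(T)`. -/
def V (T : Simplex d) : Set (Pt d) := Set.range T.vertex

/-- The edge set `ℰ(T)`. -/
def E (T : Simplex d) : Set (Sym2 (Pt d)) :=
  {e | ∃ i j : Fin (d + 1), i ≠ j ∧ e = s(T.vertex i, T.vertex j)}

/-- The closed simplex (convex hull of the vertices). -/
def hull (T : Simplex d) : Set (Pt d) := convexHull ℝ (Set.range T.vertex)

/-- The level `⌈gen/d⌉` of a `d`-simplex. -/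
def lvl (T : Simplex d) : ℤ := lvlZ d T.gen

/-- The type of a `d`-simplex. -/
def typ (T : Simplex d) : ℤ := typZ d T.gen

end Simplex

variable {d : ℕ}

/-- Membership in the master tree generated from the initial triangulation `T0`. -/
inductive MemM (T0 : Finset (Simplex d)) : Simplex d → Prop
  | init {T : Simplex d} : T ∈ T0 → MemM T0 T
  | child {T T' : Simplex d} : MemM T0 T → T'.IsChild T → MemM T0 T'

/-- `Refines 𝒯₁ 𝒯₂` : the partition `𝒯₂` is obtained from `𝒯₁` by finitely many
single bisections. -/
inductive Refines : Finset (Simplex d) → Finset (Simplex d) → Prop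
  | refl (𝒯 : Finset (Simplex d)) : Refines 𝒯 𝒯
  | step {𝒯₁ 𝒯₂ : Finset (Simplex d)} (T : Simplex d) :
      Refines 𝒯₁ 𝒯₂ → T ∈ 𝒯₂ →
      Refines 𝒯₁ (insert T.child1 (insert T.child2 (𝒯₂.erase T)))

/-- The subsimplex of `T` spanned by the vertex positions in `s`. -/
def faceSet (T : Simplex d) (s : Finset (Fin (d + 1))) : Set (Pt d) :=
  convexHull ℝ (T.vertex '' ↑s)

/-- Conformity: any two simplices meet in the empty set or in a common subsimplex. -/
def Conforming (𝒯 : Finset (Simplex d)) : Prop :=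
  ∀ T₁ ∈ 𝒯, ∀ T₂ ∈ 𝒯,
    T₁.hull ∩ T₂.hull = ∅ ∨
      ∃ s₁ s₂ : Finset (Fin (d + 1)), s₁.Nonempty ∧ s₂.Nonempty ∧
        T₁.hull ∩ T₂.hull = faceSet T₁ s₁ ∧ T₁.hull ∩ T₂.hull = faceSet T₂ s₂

/-- The conforming triangulations obtained from `T0` by successive bisections. -/
def Bisec (T0 : Finset (Simplex d)) : Set (Finset (Simplex d)) :=
  {𝒯 | Refines T0 𝒯 ∧ Conforming 𝒯}

/-- All vertices of a triangulation. -/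
def verticesOf (𝒯 : Finset (Simplex d)) : Set (Pt d) := ⋃ T ∈ 𝒯, T.V

/-- All edges of a triangulation. -/
def edgesOf (𝒯 : Finset (Simplex d)) : Set (Sym2 (Pt d)) := ⋃ T ∈ 𝒯, T.E

/-- Midpoint of an edge; this is the bisection vertex of the edge. -/
def edgeMid (e : Sym2 (Pt d)) : Pt d :=
  Sym2.lift ⟨fun a b => midpoint ℝ a b, fun a b => midpoint_comm a b⟩ e

/-- The closed segment covered by an edge. -/
def edgeSeg (e : Sym2 (Pt d)) : Set (Pt d) :=
  Sym2.lift ⟨fun a b => segment ℝ a b, fun a b => segment_symm ℝ a b⟩ e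

/-- A colored conforming initial triangulation (with the vertices of each initial
simplex ordered so that the colors read `(d, 0, 1, …, d-1)`), together with the
induced generation function on all vertices of the master tree. -/
structure ColoredSetup (d : ℕ) where
  T0 : Finset (Simplex d)
  indep : ∀ T ∈ T0, AffineIndependent ℝ T.vertex
  gen_zero : ∀ T ∈ T0, T.gen = 0
  conf : Conforming T0
  disjInt : ∀ T₁ ∈ T0, ∀ T₂ ∈ T0, T₁ ≠ T₂ → interior T₁.hull ∩ interior T₂.hull = ∅
  color : Pt d → ℕ
  color_zero : ∀ T ∈ T0, color (T.vertex 0) = d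
  color_succ : ∀ T ∈ T0, ∀ i : Fin (d + 1), (i : ℕ) ≠ 0 → color (T.vertex i) = (i : ℕ) - 1
  vgen : Pt d → ℤ
  vgen_init : ∀ T ∈ T0, ∀ i : Fin (d + 1), vgen (T.vertex i) = -(color (T.vertex i) : ℤ)
  vgen_bsv : ∀ T : Simplex d, MemM T0 T → vgen T.bsv = (T.gen : ℤ) + 1

namespace ColoredSetup

variable {d : ℕ} (S : ColoredSetup d)

/-- Level of a vertex. -/
def lvlV (v : Pt d) : ℤ := lvlZ d (S.vgen v)

/-- Type of a vertex. -/
def typV (v : Pt d) : ℤ := typZ d (S.vgen v)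

/-- Generation of an edge: the maximal generation of its endpoints. -/
def genE (e : Sym2 (Pt d)) : ℤ :=
  Sym2.lift ⟨fun a b => max (S.vgen a) (S.vgen b), fun a b => max_comm _ _⟩ e

/-- Level of an edge. -/
def lvlE (e : Sym2 (Pt d)) : ℤ := lvlZ d (S.genE e)

/-- Type of an edge. -/
def typE (e : Sym2 (Pt d)) : ℤ := typZ d (S.genE e)

/-- `gen#` of an edge: the generation of its bisection vertex (= its midpoint). -/
def genSharpE (e : Sym2 (Pt d)) : ℤ := S.vgen (edgeMid e)

/-- `level#` of an edge. -/
def lvlSharpE (e : Sym2 (Pt d)) : ℤ := lvlZ d (S.genSharpE e)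

/-- `type#` of an edge. -/
def typSharpE (e : Sym2 (Pt d)) : ℤ := typZ d (S.genSharpE e)

end ColoredSetup

/-- Chains of pairwise intersecting simplices of length `N`. -/
def IsSimChain (𝒮 : Set (Simplex d)) (T T' : Simplex d) (N : ℕ) : Prop :=
  ∃ f : Fin (N + 1) → Simplex d, (∀ i, f i ∈ 𝒮) ∧ f 0 = T ∧ f (Fin.last N) = T' ∧
    ∀ i : Fin N, ((f i.castSucc).hull ∩ (f i.succ).hull).Nonempty

/-- The simplex distance `δ_𝒯`. -/
def simDist (𝒯 : Finset (Simplex d)) (T T' : Simplex d) : ℕ :=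
  sInf {N | IsSimChain (↑𝒯) T T' N}

/-- Chains of `1`-neighbours (consecutive simplices share an edge). -/
def Is1Chain (𝒮 : Set (Simplex d)) (T T' : Simplex d) (N : ℕ) : Prop :=
  ∃ f : Fin (N + 1) → Simplex d, (∀ i, f i ∈ 𝒮) ∧ f 0 = T ∧ f (Fin.last N) = T' ∧
    ∀ i : Fin N, ((f i.castSucc).E ∩ (f i.succ).E).Nonempty

/-- The `1`-distance `δ¹_𝒮`. -/
def dist1 (𝒮 : Set (Simplex d)) (T T' : Simplex d) : ℕ :=
  sInf {N | Is1Chain 𝒮 T T' N}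

/-- The uniform patch `ω_{𝒯₀⁺}(v)` in the full uniform refinement `𝒯₀⁺`. -/
def patchPlus (S : ColoredSetup d) (v : Pt d) : Set (Simplex d) :=
  {T | MemM S.T0 T ∧ T.gen = d ∧ v ∈ T.V}

/-- The constant `C(𝒯₀)`. -/
def Cconst (S : ColoredSetup d) : ℕ :=
  sSup {n | ∃ v ∈ verticesOf S.T0, ∃ T ∈ patchPlus S v, ∃ T' ∈ patchPlus S v,
    n = dist1 (patchPlus S v) T T'}

/-- `v` lies in some `n`-subsimplex of an initial simplex. -/
def InMacroSub (S : ColoredSetup d) (n : ℕ) (v : Pt d) : Prop :=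
  ∃ T ∈ S.T0, ∃ s : Finset (Fin (d + 1)), s.card = n + 1 ∧ v ∈ convexHull ℝ (T.vertex '' ↑s)

/-- `v` is an `n`-macro vertex. -/
def IsMacro (S : ColoredSetup d) (n : ℕ) (v : Pt d) : Prop :=
  InMacroSub S n v ∧ ∀ m : ℕ, m < n → ¬ InMacroSub S m v

/-- The maximal level jump at a vertex `v`. -/
def jump (S : ColoredSetup d) (v : Pt d) : ℕ :=
  sSup {n | ∃ 𝒯 ∈ Bisec S.T0, ∃ e ∈ edgesOf 𝒯, ∃ e' ∈ edgesOf 𝒯,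
    v ∈ e ∧ v ∈ e' ∧ (n : ℤ) = |S.lvlE e - S.lvlE e'|}

/-- The constants `J_n`. -/
def J (S : ColoredSetup d) (n : ℕ) : ℤ :=
  if n = 0 then ⌈((Cconst S : ℚ) + 1) * (1 - 1 / (d : ℚ))⌉ - 2
  else if n ≤ d - 2 then 2 else 0

/-- The constant `Γ = 1 + Σ_{n=0}^{d-2} J_n`. -/
def Gam (S : ColoredSetup d) : ℤ := 1 + ∑ n ∈ Finset.range (d - 1), J S n

/-- The edges spanned by a set of points. -/
def edgeOfSet (A : Set (Pt d)) : Set (Sym2 (Pt d)) :=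
  {e | ∃ a ∈ A, ∃ b ∈ A, a ≠ b ∧ e = s(a, b)}

/-- `FirstBisected A T e` : along descendants of `T` that keep all points of `A` as
vertices, `e` is the first edge spanned by points of `A` which occurs as a bisection
edge, i.e. the edge of the subsimplex spanned by `A` that is bisected first. -/
inductive FirstBisected (A : Set (Pt d)) : Simplex d → Sym2 (Pt d) → Prop
  | found {T : Simplex d} : T.bse ∈ edgeOfSet A → FirstBisected A T T.bse
  | step {T T' : Simplex d} {e : Sym2 (Pt d)} :
      T.bse ∉ edgeOfSet A → T'.IsChild T → A ⊆ T'.V →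
      FirstBisected A T' e → FirstBisected A T e

/-- The uniform vertex patch `ω_m(v)`. -/
def patchU (S : ColoredSetup d) (m : ℕ) (v : Pt d) : Set (Simplex d) :=
  {T | MemM S.T0 T ∧ T.gen = m * d ∧ v ∈ T.V}

/-- The patch boundary `∂ω_m(v)`: union of the `(d-1)`-subsimplices of members of
`ω_m(v)` not containing `v`. -/
def patchBd (S : ColoredSetup d) (m : ℕ) (v : Pt d) : Set (Pt d) :=
  ⋃ T ∈ patchU S m v,
    ⋃ s ∈ {s : Finset (Fin (d + 1)) | s.card = d ∧ v ∉ convexHull ℝ (T.vertex '' ↑s)},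
      convexHull ℝ (T.vertex '' ↑s)

/-- The neighbourhood `Ω_m(v)`. -/
def nbhd (S : ColoredSetup d) (m : ℕ) (v : Pt d) : Set (Pt d) :=
  (⋃ T ∈ patchU S m v, T.hull) \ patchBd S m v

/-- The Kuhn simplex `T_π = [0, e_{π(1)}, e_{π(1)}+e_{π(2)}, …]`, of generation `0`. -/
def kuhnSimplex (d : ℕ) (π : Equiv.Perm (Fin d)) : Simplex d where
  vertex := fun i x => if ((π.symm x : ℕ)) < (i : ℕ) then 1 else 0
  gen := 0

/-- The average diameter `h₀` of the initial triangulation. -/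
def avgDiam (T0 : Finset (Simplex d)) : ℝ :=
  (∑ T ∈ T0, Metric.diam T.hull) / T0.card

/-- The regularized mesh size function `h_𝒯`. -/
def regMesh (T0 𝒯 : Finset (Simplex d)) (T : Simplex d) : ℝ :=
  avgDiam T0 * sInf {x : ℝ | ∃ T' ∈ 𝒯, x = (2 : ℝ) ^ (-(T'.lvl) + (simDist 𝒯 T T' : ℤ))}

lemma lvlZ_eq (d : ℕ) {g n : ℤ} (h₁ : d * n + 1 ≤ g) (h₂ : g ≤ d * n + d) :
    lvlZ d g = n + 1 := by
  unfold lvlZ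
  have hd : (0 : ℤ) < d := by omega
  apply le_antisymm
  · rw [← Int.lt_add_one_iff, Int.ediv_lt_iff_lt_mul hd]
    linarith
  · rw [Int.le_ediv_iff_mul_le hd]
    linarith

lemma lvlZ_add_self {d : ℕ} (hd : 0 < d) (g : ℤ) : lvlZ d (g + d) = lvlZ d g + 1 := by
  unfold lvlZ
  rw [show g + d + d - 1 = g + d - 1 + d by ring, Int.add_ediv_of_dvd_right (dvd_refl _),
    Int.ediv_self (by omega)]

lemma typZ_add_self {d : ℕ} (hd : 0 < d) (g : ℤ) : typZ d (g + d) = typZ d g := by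
  unfold typZ
  rw [lvlZ_add_self hd]
  ring

namespace Simplex

variable {d : ℕ} (T : Simplex d)

lemma k_pos (hd : 0 < d) : 0 < T.k := Nat.sub_pos_of_lt (Nat.mod_lt _ hd)

lemma gen_add_k (hd : 0 < d) : T.gen + T.k = d * (T.gen / d) + d := by
  have h₁ := Nat.div_add_mod T.gen d
  have h₂ := Nat.mod_lt T.gen hd
  unfold k
  omega

variable {T}

lemma k_and_div_eq {q k : ℕ} (h : T.gen + k = d * q + d) (hk : 0 < k) (hkd : k ≤ d) :
    T.k = k ∧ T.gen / d = q := by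
  have hg : T.gen = d - k + d * q := by omega
  have hlt : d - k < d := by omega
  constructor
  · simp only [Simplex.k, hg, Nat.add_mul_mod_self_left, Nat.mod_eq_of_lt hlt]
    omega
  · rw [hg, Nat.add_mul_div_left _ _ (by omega), Nat.div_eq_of_lt hlt, zero_add]

variable {T' : Simplex d}

lemma IsChild.gen_eq (h : T'.IsChild T) : T'.gen = T.gen + 1 := by
  rcases h with rfl | rfl <;> rfl

lemma IsChild.k_and_div_of_one_lt (h : T'.IsChild T) (hk : 1 < T.k) :
    T'.k = T.k - 1 ∧ T'.gen / d = T.gen / d := by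
  have := T.k_le
  have := T.gen_add_k (by omega)
  have := h.gen_eq
  exact k_and_div_eq (by omega) (by omega) (by omega)

lemma IsChild.k_and_div_of_eq_one (h : T'.IsChild T) (hk : T.k = 1) :
    T'.k = d ∧ T'.gen / d = T.gen / d + 1 := by
  have := T.k_le
  have := T.gen_add_k (by omega)
  have := h.gen_eq
  exact k_and_div_eq (by rw [mul_add, mul_one]; omega) (by omega) le_rfl

lemma IsChild.k_cases (h : T'.IsChild T) (hd : 0 < d) :
    (1 < T.k ∧ T'.k = T.k - 1) ∨ (T.k = 1 ∧ T'.k = d) := by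
  have := T.k_pos hd
  by_cases h1 : T.k = 1
  · exact Or.inr ⟨h1, (h.k_and_div_of_eq_one h1).1⟩
  · exact Or.inl ⟨by omega, (h.k_and_div_of_one_lt (by omega)).1⟩

lemma child1_vertex_of_ne {i : Fin (d + 1)} (h : (i : ℕ) ≠ T.k) :
    T.child1.vertex i = T.vertex i :=
  Function.update_of_ne (fun hi => h (congrArg Fin.val hi)) _ _

lemma child1_vertex_kIdx : T.child1.vertex T.kIdx = T.bsv :=
  Function.update_self _ _ _

lemma child2_vertex_of_lt {i j : Fin (d + 1)} (h : (i : ℕ) < T.k) (hj : (j : ℕ) = i + 1) :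
    T.child2.vertex i = T.vertex j := by
  simp only [child2, h, dif_pos]
  congr 1
  exact Fin.ext hj.symm

lemma child2_vertex_kIdx : T.child2.vertex T.kIdx = T.bsv := by
  simp [child2, kIdx]

lemma child2_vertex_of_gt {i : Fin (d + 1)} (h : T.k < (i : ℕ)) :
    T.child2.vertex i = T.vertex i := by
  simp [child2, h.not_gt, h.ne']

variable (T) in
/-- The generation of the midpoint of the edge joining the vertices at positions `i < j`. -/
def edgeSharp (i j : ℕ) : ℕ :=
  if j ≤ T.k then T.gen + T.k + 1 + i - j
  else if i ≤ T.k then T.gen + T.k + d + 1 - j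
  else T.gen + T.k + d + 1 + i - j

lemma gen_lt_edgeSharp {i j : ℕ} (hd : 0 < d) (hj : j ≤ d)
    (h : ¬(i = 0 ∧ j = T.k)) : T.gen + 1 < T.edgeSharp i j := by
  have := T.k_pos hd
  unfold edgeSharp
  split_ifs <;> omega

end Simplex

/-- Every edge of a simplex of the master tree is the bisection edge of some simplex of the
master tree. -/
lemma MemM.exists_bse_eq {d : ℕ} (hd : 0 < d) {T0 : Finset (Simplex d)} {T : Simplex d}
    (hT : MemM T0 T) {i j : Fin (d + 1)} (hij : (i : ℕ) < j) :
    ∃ T', MemM T0 T' ∧ T'.bse = s(T.vertex i, T.vertex j) ∧ T'.gen + 1 = T.edgeSharp i j := by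
  obtain ⟨n, hn⟩ : ∃ n, n = T.edgeSharp i j - T.gen := ⟨_, rfl⟩
  induction n generalizing T i j with
  | zero =>
    have hk := T.k_pos hd
    have hi := i.isLt
    have hj := j.isLt
    unfold Simplex.edgeSharp at hn
    split_ifs at hn <;> omega
  | succ n ih =>
    have hk := T.k_pos hd
    have hkd := T.k_le
    have hi := i.isLt
    have hj := j.isLt
    by_cases h0 : (i : ℕ) = 0 ∧ (j : ℕ) = T.k
    · refine ⟨T, hT, ?_, ?_⟩
      · have hi' : i = 0 := Fin.ext h0.1
        have hj' : j = T.kIdx := Fin.ext h0.2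
        rw [Simplex.bse, hi', hj']
      · unfold Simplex.edgeSharp
        split_ifs <;> omega
    have hlt := Simplex.gen_lt_edgeSharp (T := T) hd (by omega) h0
    suffices ∃ (T' : Simplex d) (i' j' : Fin (d + 1)), T'.IsChild T ∧ (i' : ℕ) < j' ∧
        T'.vertex i' = T.vertex i ∧ T'.vertex j' = T.vertex j ∧
        T'.edgeSharp i' j' = T.edgeSharp i j by
      obtain ⟨T', i', j', hc, hij', hvi, hvj, hs⟩ := this
      have := hc.gen_eq
      obtain ⟨T'', hM, hb, hg⟩ := ih (hT.child hc) hij' (by omega)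
      exact ⟨T'', hM, by rw [hb, hvi, hvj], by rw [hg, hs]⟩
    by_cases hik : (i : ℕ) = T.k
    · have hc : T.child2.IsChild T := Or.inr rfl
      refine ⟨T.child2, ⟨i - 1, by omega⟩, j, hc, ?_, ?_, ?_, ?_⟩
      · simp only
        omega
      · exact Simplex.child2_vertex_of_lt (by simp only; omega) (by simp only; omega)
      · exact Simplex.child2_vertex_of_gt (by omega)
      · have := hc.gen_eq
        have := hc.k_cases hd
        simp only [Simplex.edgeSharp]
        split_ifs <;> omega
    by_cases hjk : (j : ℕ) = T.k
    · have hc : T.child2.IsChild T := Or.inr rfl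
      refine ⟨T.child2, ⟨i - 1, by omega⟩, ⟨j - 1, by omega⟩, hc, ?_, ?_, ?_, ?_⟩
      · simp only
        omega
      · exact Simplex.child2_vertex_of_lt (by simp only; omega) (by simp only; omega)
      · exact Simplex.child2_vertex_of_lt (by simp only; omega) (by simp only; omega)
      · have := hc.gen_eq
        have := hc.k_cases hd
        simp only [Simplex.edgeSharp]
        split_ifs <;> omega
    · have hc : T.child1.IsChild T := Or.inl rfl
      refine ⟨T.child1, i, j, hc, hij, Simplex.child1_vertex_of_ne hik,
        Simplex.child1_vertex_of_ne hjk, ?_⟩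
      have := hc.gen_eq
      have := hc.k_cases hd
      simp only [Simplex.edgeSharp]
      split_ifs <;> omega

namespace ColoredSetup

variable {d : ℕ} (S : ColoredSetup d) {T : Simplex d}

lemma genSharpE_bse (hT : MemM S.T0 T) : S.genSharpE T.bse = (T.gen : ℤ) + 1 :=
  S.vgen_bsv T hT

lemma genSharpE_eq (hd : 0 < d) (hT : MemM S.T0 T) {i j : Fin (d + 1)} (hij : (i : ℕ) < j) :
    S.genSharpE s(T.vertex i, T.vertex j) = T.edgeSharp i j := by
  obtain ⟨T', hT', hb, hg⟩ := hT.exists_bse_eq hd hij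
  rw [← hb, S.genSharpE_bse hT', ← hg]
  push_cast
  rfl

/-- Vertices at positions beyond `k` belong to level `gen T / d + 1`, the remaining ones have
at most level `gen T / d`, with equality except possibly at position `0`. -/
lemma vgen_bounds (hd : 0 < d) (hT : MemM S.T0 T) (i : Fin (d + 1)) :
    (T.k < i → (d * (T.gen / d) : ℕ) + 1 ≤ S.vgen (T.vertex i) ∧
      S.vgen (T.vertex i) ≤ (d * (T.gen / d) : ℕ) + d) ∧
    ((i : ℕ) ≤ T.k → S.vgen (T.vertex i) ≤ (d * (T.gen / d) : ℕ)) ∧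
    ((i : ℕ) ≤ T.k → (i : ℕ) ≠ 0 →
      (d * (T.gen / d) : ℕ) + 1 ≤ S.vgen (T.vertex i) + d) := by
  induction hT generalizing i with
  | @init T hT0 =>
    have hg := S.gen_zero T hT0
    have hk : T.k = d := by simp [Simplex.k, hg]
    have hv := S.vgen_init T hT0 i
    have hi := i.isLt
    by_cases h0 : i = 0
    · subst h0
      rw [S.color_zero T hT0] at hv
      simp only [hg, hk, Nat.zero_div, mul_zero, Fin.val_zero]
      omega
    · have h0' : (i : ℕ) ≠ 0 := fun h => h0 (Fin.ext h)
      rw [S.color_succ T hT0 i h0'] at hv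
      simp only [hg, hk, Nat.zero_div, mul_zero]
      omega
  | @child T T' hT hc ih =>
    have hk := T.k_pos hd
    have hkd := T.k_le
    have hsum := T.gen_add_k hd
    have hb := S.vgen_bsv T hT
    have hi := i.isLt
    have key : ((i : ℕ) = T.k ∧ S.vgen (T'.vertex i) = T.gen + 1) ∨
        ((i : ℕ) ≠ T.k ∧ T'.vertex i = T.vertex i) ∨
        ∃ j : Fin (d + 1), (i : ℕ) < T.k ∧ (j : ℕ) = i + 1 ∧ T'.vertex i = T.vertex j := by
      by_cases hik : (i : ℕ) = T.k
      · have : i = T.kIdx := Fin.ext hik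
        subst this
        rcases hc with rfl | rfl
        · exact Or.inl ⟨hik, by rw [Simplex.child1_vertex_kIdx, hb]⟩
        · exact Or.inl ⟨hik, by rw [Simplex.child2_vertex_kIdx, hb]⟩
      · rcases hc with rfl | rfl
        · exact Or.inr (Or.inl ⟨hik, Simplex.child1_vertex_of_ne hik⟩)
        · rcases Nat.lt_or_gt_of_ne hik with h | h
          · exact Or.inr (Or.inr ⟨⟨i + 1, by omega⟩, h, rfl,
              Simplex.child2_vertex_of_lt h rfl⟩)
          · exact Or.inr (Or.inl ⟨hik, Simplex.child2_vertex_of_gt h⟩)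
    have step : (1 < T.k ∧ T'.k = T.k - 1 ∧ d * (T'.gen / d) = d * (T.gen / d)) ∨
        (T.k = 1 ∧ T'.k = d ∧ d * (T'.gen / d) = d * (T.gen / d) + d) := by
      by_cases h1 : T.k = 1
      · obtain ⟨h2, h3⟩ := hc.k_and_div_of_eq_one h1
        exact Or.inr ⟨h1, h2, by rw [h3, mul_add, mul_one]⟩
      · obtain ⟨h2, h3⟩ := hc.k_and_div_of_one_lt (by omega)
        exact Or.inl ⟨by omega, h2, by rw [h3]⟩
    generalize d * (T'.gen / d) = q' at *
    generalize d * (T.gen / d) = q at *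
    rcases key with ⟨h1, h2⟩ | ⟨h1, h2⟩ | ⟨j, h1, h2, h3⟩
    · omega
    · have := ih i
      rw [h2]
      omega
    · have := ih j
      rw [h3]
      omega

lemma lvlSharpE_eq_lvlE_add_one (hd : 0 < d) (hT : MemM S.T0 T) {i j : Fin (d + 1)}
    (hij : (i : ℕ) < j) :
    S.lvlSharpE s(T.vertex i, T.vertex j) = S.lvlE s(T.vertex i, T.vertex j) + 1 := by
  have hsum := T.gen_add_k hd
  have hk := T.k_pos hd
  have hkd := T.k_le
  have hi := S.vgen_bounds hd hT i
  have hj := S.vgen_bounds hd hT j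
  have hj' := j.isLt
  have hmax : S.genE s(T.vertex i, T.vertex j) =
      max (S.vgen (T.vertex i)) (S.vgen (T.vertex j)) := rfl
  have hq : ((d * (T.gen / d) : ℕ) : ℤ) = d * ((T.gen / d : ℕ) : ℤ) := by push_cast; rfl
  unfold lvlSharpE lvlE
  rw [S.genSharpE_eq hd hT hij, hmax]
  generalize T.gen / d = n at *
  by_cases hjk : (j : ℕ) ≤ T.k
  · rw [lvlZ_eq d (n := (n : ℤ)), lvlZ_eq d (n := (n : ℤ) - 1)]
    · ring
    · rw [mul_sub, mul_one]
      omega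
    · rw [mul_sub, mul_one]
      omega
    all_goals
      unfold Simplex.edgeSharp
      split_ifs
      omega
  · rw [lvlZ_eq d (n := (n : ℤ) + 1), lvlZ_eq d (n := (n : ℤ))]
    · omega
    · omega
    all_goals
      rw [mul_add, mul_one]
      unfold Simplex.edgeSharp
      split_ifs <;> omega

/-- Passing from the bisection edge to one of its halves increases the generation of the
midpoint by `d`. -/
lemma genSharpE_halves (hd : 0 < d) (hT : MemM S.T0 T) :
    S.genSharpE s(T.bsv, T.vertex 0) = S.genSharpE T.bse + d ∧
    S.genSharpE s(T.bsv, T.vertex T.kIdx) = S.genSharpE T.bse + d := by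
  have hk := T.k_pos hd
  have hkd := T.k_le
  rw [S.genSharpE_bse hT]
  constructor
  · have hc : T.child1.IsChild T := Or.inl rfl
    have hg := hc.gen_eq
    have hs := hc.k_cases hd
    have h := S.genSharpE_eq hd (hT.child hc) (i := 0) (j := T.kIdx) hk
    rw [Simplex.child1_vertex_kIdx, Simplex.child1_vertex_of_ne (by simp only [Fin.val_zero]; omega),
      Sym2.eq_swap] at h
    have hv : T.child1.edgeSharp (0 : Fin (d + 1)) T.kIdx = T.gen + 1 + d := by
      change T.child1.edgeSharp 0 T.k = _
      unfold Simplex.edgeSharp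
      split_ifs <;> omega
    rw [h, hv]
    push_cast
    rfl
  · have hc : T.child2.IsChild T := Or.inr rfl
    have hg := hc.gen_eq
    have hs := hc.k_cases hd
    have h := S.genSharpE_eq hd (hT.child hc) (i := ⟨T.k - 1, by omega⟩) (j := T.kIdx)
      (by simp only [Simplex.kIdx]; omega)
    rw [Simplex.child2_vertex_kIdx, Simplex.child2_vertex_of_lt (j := T.kIdx)
      (by simp only; omega) (by simp only [Simplex.kIdx]; omega), Sym2.eq_swap] at h
    have hv : T.child2.edgeSharp (T.k - 1) T.kIdx = T.gen + 1 + d := by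
      change T.child2.edgeSharp (T.k - 1) T.k = _
      unfold Simplex.edgeSharp
      split_ifs <;> omega
    rw [h, hv]
    push_cast
    rfl

lemma genSharpE_bse_lt (hd : 0 < d) (hT : MemM S.T0 T) {i j : Fin (d + 1)} (hij : (i : ℕ) < j)
    (hne : s(T.vertex i, T.vertex j) ≠ T.bse) :
    S.genSharpE T.bse < S.genSharpE s(T.vertex i, T.vertex j) := by
  rw [S.genSharpE_bse hT, S.genSharpE_eq hd hT hij]
  have hj := j.isLt
  have := Simplex.gen_lt_edgeSharp (T := T) (i := i) (j := j) hd (by omega) fun h => hne <| by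
    have hi' : i = 0 := Fin.ext h.1
    have hj' : j = T.kIdx := Fin.ext h.2
    rw [Simplex.bse, hi', hj']
  omega

lemma genSharpE_lt_of_firstBisected (hd : 0 < d) {A : Set (Pt d)} {e : Sym2 (Pt d)}
    (h : FirstBisected A T e) (hT : MemM S.T0 T) (hA : A ⊆ T.V) {e' : Sym2 (Pt d)}
    (he' : e' ∈ edgeOfSet A) (hne : e' ≠ e) : S.genSharpE e < S.genSharpE e' := by
  induction h with
  | @found T _ =>
    obtain ⟨a, ha, b, hb, hab, rfl⟩ := he'
    obtain ⟨i, rfl⟩ := hA ha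
    obtain ⟨j, rfl⟩ := hA hb
    have hij : (i : ℕ) ≠ j := fun h => hab (congrArg T.vertex (Fin.ext h))
    rcases Nat.lt_or_gt_of_ne hij with h | h
    · exact S.genSharpE_bse_lt hd hT h hne
    · rw [Sym2.eq_swap] at hne ⊢
      exact S.genSharpE_bse_lt hd hT h hne
  | step _ hc hA' _ ih => exact ih (hT.child hc) hA' hne

end ColoredSetup

lemma Simplex.exists_lt_of_mem_E {d : ℕ} {T : Simplex d} {e : Sym2 (Pt d)} (he : e ∈ T.E) :
    ∃ i j : Fin (d + 1), (i : ℕ) < j ∧ e = s(T.vertex i, T.vertex j) := by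
  obtain ⟨i, j, hij, rfl⟩ := he
  rcases lt_or_gt_of_ne hij with h | h
  · exact ⟨i, j, h, rfl⟩
  · exact ⟨j, i, h, Sym2.eq_swap⟩

theorem sharp_generation_properties (d : ℕ) (hd : 2 ≤ d) (S : ColoredSetup d)
    (T : Simplex d) (hT : MemM S.T0 T) :
    (∀ e ∈ T.E, S.lvlSharpE e = S.lvlE e + 1) ∧
    (∀ m : ℕ, 2 ≤ m → ∀ A : Finset (Pt d), A.card = m + 1 → ↑A ⊆ T.V →
      ∀ e, FirstBisected (↑A : Set (Pt d)) T e →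
        ∀ e' ∈ edgeOfSet (↑A : Set (Pt d)), e' ≠ e → S.genSharpE e < S.genSharpE e') ∧
    ((T.gen : ℤ) + 1 = S.genSharpE T.bse) ∧
    (∀ e ∈ T.E, ∀ a b : Pt d, e = s(a, b) →
      S.genSharpE s(edgeMid e, a) = S.genSharpE e + d ∧
      S.genSharpE s(edgeMid e, b) = S.genSharpE e + d ∧
      S.lvlSharpE s(edgeMid e, a) = S.lvlSharpE e + 1 ∧
      S.lvlSharpE s(edgeMid e, b) = S.lvlSharpE e + 1 ∧
      S.typSharpE s(edgeMid e, a) = S.typSharpE e ∧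
      S.typSharpE s(edgeMid e, b) = S.typSharpE e) := by
  have hd0 : 0 < d := by omega
  refine ⟨fun e he => ?_, fun m _ A _ hA e h e' he' hne =>
    S.genSharpE_lt_of_firstBisected hd0 h hT hA he' hne, (S.genSharpE_bse hT).symm,
    fun e he a b hab => ?_⟩
  · obtain ⟨i, j, hij, rfl⟩ := Simplex.exists_lt_of_mem_E he
    exact S.lvlSharpE_eq_lvlE_add_one hd0 hT hij
  · suffices h : S.genSharpE s(edgeMid e, a) = S.genSharpE e + d ∧
        S.genSharpE s(edgeMid e, b) = S.genSharpE e + d by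
      unfold ColoredSetup.lvlSharpE ColoredSetup.typSharpE
      rw [h.1, h.2, lvlZ_add_self hd0, typZ_add_self hd0]
      exact ⟨rfl, rfl, rfl, rfl, rfl, rfl⟩
    obtain ⟨i, j, hij, he⟩ := Simplex.exists_lt_of_mem_E he
    obtain ⟨T', hT', hb, -⟩ := hT.exists_bse_eq hd0 hij
    obtain ⟨h₁, h₂⟩ := S.genSharpE_halves hd0 hT'
    have heb : e = T'.bse := he.trans hb.symm
    have hm : edgeMid e = T'.bsv := by rw [heb]; rfl
    rw [hm, heb]
    rw [heb, Simplex.bse, Sym2.eq_iff] at hab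
    rcases hab with ⟨rfl, rfl⟩ | ⟨rfl, rfl⟩
    · exact ⟨h₁, h₂⟩
    · exact ⟨h₂, h₁⟩

end BisecGrading
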